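/- Let X be a finite set, let c, t : X×X → [0,∞) be cost functions, and let ν, μ₁, …, μ_n be distributions on X. Let μ* be a distribution among μ₁,…,μ_n minimizing W_c(·, ν). Suppose A, B > 0 are such that: (i) c(x,y) ≤ A·t(x,y) for every x in the union of the supports of μ₁,…,μ_n and every y in the support of ν; and (ii) there exists a coupling f* of (μ*, ν) with Σ_{x,y} f*(x,y)·c(x,y) = W_c(μ*, ν) and Σ_{x,y} f*(x,y)·t(x,y) ≤ B·W_c(μ*, ν). Then every index i' minimizing W_t(μ_{i'}, ν) over i = 1,…,n satisfies W_c(μ_{i'}, ν) ≤ A·B·W_c(μ*, ν). -/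

import Mathlib

/-- `μ` is a probability distribution on the finite type `X`. -/
def IsDist {X : Type*} [Fintype X] (μ : X → ℝ) : Prop :=
  (∀ x, 0 ≤ μ x) ∧ ∑ x, μ x = 1

/-- `τ` is a coupling of the distributions `μ` and `ν` on the finite type `X`. -/
def IsCoupling {X : Type*} [Fintype X] (μ ν : X → ℝ) (τ : X → X → ℝ) : Prop :=
  (∀ x y, 0 ≤ τ x y) ∧ (∀ x, ∑ y, τ x y = μ x) ∧ (∀ y, ∑ x, τ x y = ν y)

/-- The optimal transport cost `W_c(μ,ν)`: the minimum of `Σ_{x,y} τ(x,y)·c(x,y)` over all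
couplings `τ` of `(μ,ν)` (expressed as an infimum; it is attained by compactness). -/
noncomputable def W {X : Type*} [Fintype X] (c : X → X → ℝ) (μ ν : X → ℝ) : ℝ :=
  sInf {v | ∃ τ, IsCoupling μ ν τ ∧ v = ∑ x, ∑ y, τ x y * c x y}

theorem IsCoupling.prod {X : Type*} [Fintype X] {μ ν : X → ℝ} (hμ : IsDist μ) (hν : IsDist ν) :
    IsCoupling μ ν fun x y => μ x * ν y := by
  refine ⟨fun x y => mul_nonneg (hμ.1 x) (hν.1 y), fun x => ?_, fun y => ?_⟩
  · rw [← Finset.mul_sum, hν.2, mul_one]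
  · rw [← Finset.sum_mul, hμ.2, one_mul]

theorem IsCoupling.pos_left {X : Type*} [Fintype X] {μ ν : X → ℝ} {τ : X → X → ℝ}
    (h : IsCoupling μ ν τ) {x y : X} (hxy : 0 < τ x y) : 0 < μ x :=
  hxy.trans_le <| h.2.1 x ▸
    Finset.single_le_sum (f := fun y => τ x y) (fun z _ => h.1 x z) (Finset.mem_univ y)

theorem IsCoupling.pos_right {X : Type*} [Fintype X] {μ ν : X → ℝ} {τ : X → X → ℝ}
    (h : IsCoupling μ ν τ) {x y : X} (hxy : 0 < τ x y) : 0 < ν y :=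
  hxy.trans_le <| h.2.2 y ▸
    Finset.single_le_sum (f := fun x => τ x y) (fun z _ => h.1 z y) (Finset.mem_univ x)

theorem W_le_of_isCoupling {X : Type*} [Fintype X] {c : X → X → ℝ} (hc : ∀ x y, 0 ≤ c x y)
    {μ ν : X → ℝ} {τ : X → X → ℝ} (h : IsCoupling μ ν τ) :
    W c μ ν ≤ ∑ x, ∑ y, τ x y * c x y := by
  refine csInf_le ⟨0, ?_⟩ ⟨τ, h, rfl⟩
  rintro _ ⟨σ, hσ, rfl⟩
  exact Finset.sum_nonneg fun x _ => Finset.sum_nonneg fun y _ => mul_nonneg (hσ.1 x y) (hc x y)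

/-- A pointwise bound `c ≤ A·t` on the product of the supports passes to the transport costs. -/
theorem W_le_mul_W {X : Type*} [Fintype X] {c t : X → X → ℝ} (hc : ∀ x y, 0 ≤ c x y)
    {μ ν : X → ℝ} (hμ : IsDist μ) (hν : IsDist ν) {A : ℝ} (hA : 0 < A)
    (hcomp : ∀ x y, 0 < μ x → 0 < ν y → c x y ≤ A * t x y) :
    W c μ ν ≤ A * W t μ ν := by
  rw [← div_le_iff₀' hA]
  refine le_csInf ⟨_, _, IsCoupling.prod hμ hν, rfl⟩ ?_
  rintro _ ⟨τ, hτ, rfl⟩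
  rw [div_le_iff₀' hA]
  refine (W_le_of_isCoupling hc hτ).trans ?_
  simp only [Finset.mul_sum]
  refine Finset.sum_le_sum fun x _ => Finset.sum_le_sum fun y _ => ?_
  rcases (hτ.1 x y).eq_or_lt with h | h
  · simp [← h]
  · rw [mul_left_comm]
    exact mul_le_mul_of_nonneg_left (hcomp x y (hτ.pos_left h) (hτ.pos_right h)) h.le

/-- Comparison skeleton for the Quadtree nearest-neighbor guarantee: if `c ≤ A·t` on the
supports of the dataset versus the query, and some optimal (for `c`) coupling of the true
nearest neighbor `μ*` with `ν` has `t`-cost at most `B·W_c(μ*,ν)`, then any `t`-nearest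
neighbor `μ_{i'}` is an `A·B`-approximate `c`-nearest neighbor. -/
theorem stmt6 {X : Type*} [Fintype X] (c t : X → X → ℝ)
    (hc : ∀ x y, 0 ≤ c x y) (ht : ∀ x y, 0 ≤ t x y)
    (n : ℕ) (μ : Fin n → X → ℝ) (ν : X → ℝ)
    (hμ : ∀ i, IsDist (μ i)) (hν : IsDist ν)
    (istar : Fin n) (histar : ∀ i, W c (μ istar) ν ≤ W c (μ i) ν)
    (A B : ℝ) (hA : 0 < A) (hB : 0 < B)
    (hcomp : ∀ x y, (∃ i, 0 < μ i x) → 0 < ν y → c x y ≤ A * t x y)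
    (hflow : ∃ f, IsCoupling (μ istar) ν f ∧
      (∑ x, ∑ y, f x y * c x y) = W c (μ istar) ν ∧
      (∑ x, ∑ y, f x y * t x y) ≤ B * W c (μ istar) ν)
    (i' : Fin n) (hi' : ∀ i, W t (μ i') ν ≤ W t (μ i) ν) :
    W c (μ i') ν ≤ A * B * W c (μ istar) ν := by
  obtain ⟨f, hf, -, hft⟩ := hflow
  calc W c (μ i') ν ≤ A * W t (μ i') ν :=
        W_le_mul_W hc (hμ i') hν hA fun x y hx hy => hcomp x y ⟨i', hx⟩ hy
    _ ≤ A * (B * W c (μ istar) ν) :=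
        mul_le_mul_of_nonneg_left
          ((hi' istar).trans ((W_le_of_isCoupling ht hf).trans hft)) hA.le
    _ = A * B * W c (μ istar) ν := (mul_assoc _ _ _).symm
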